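/- Suppose W, V : ℝ → ℝ are L-periodic and twice continuously differentiable. If u : ℝ → ℝ is continuous, L-periodic and satisfies u = T u, then u is twice continuously differentiable, strictly positive, has ∫_Ω u dx = 1, and the stationary flux vanishes identically: σ u'(x) + κ u(x) (W*u)'(x) + u(x) V'(x) = 0 for every x ∈ ℝ; in particular u is a classical solution of the stationary aggregation–diffusion equation 0 = d/dx(σ ∂_x u + κ u ∂_x(W*u) + u ∂_x V). -/

import Mathlib

open MeasureTheory Real Set

/-- Periodic convolution over Ω = (-L/2, L/2]: `(W*u)(x) = ∫_Ω W(x-y) u(y) dy`. -/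
noncomputable def pconv (L : ℝ) (W u : ℝ → ℝ) (x : ℝ) : ℝ :=
  ∫ y in Set.Ioc (-(L/2)) (L/2), W (x - y) * u y

/-- Normalisation constant `Z(u)`. -/
noncomputable def Zfun (L σ κ : ℝ) (W V u : ℝ → ℝ) : ℝ :=
  ∫ y in Set.Ioc (-(L/2)) (L/2), Real.exp (-σ⁻¹ * (κ * pconv L W u y + V y))

/-- The fixed-point map `T`. -/
noncomputable def Tmap (L σ κ : ℝ) (W V u : ℝ → ℝ) (x : ℝ) : ℝ :=
  Real.exp (-σ⁻¹ * (κ * pconv L W u x + V x)) / Zfun L σ κ W V u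

theorem pconv_eq_intervalIntegral {L : ℝ} (hL : 0 ≤ L) (W u : ℝ → ℝ) (x : ℝ) :
    pconv L W u x = ∫ y in (-(L/2))..(L/2), W (x - y) * u y := by
  rw [intervalIntegral.integral_of_le (by linarith), pconv]

theorem continuous_pconv {L : ℝ} (hL : 0 ≤ L) {W u : ℝ → ℝ} (hW : Continuous W)
    (hu : Continuous u) : Continuous (pconv L W u) := by
  rw [funext (pconv_eq_intervalIntegral hL W u)]
  exact intervalIntegral.continuous_parametric_intervalIntegral_of_continuous'
    (by fun_prop) _ _

theorem hasDerivAt_pconv {L : ℝ} (hL : 0 ≤ L) {W u : ℝ → ℝ} (hW : ContDiff ℝ 1 W)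
    (hu : Continuous u) (x : ℝ) : HasDerivAt (pconv L W u) (pconv L (deriv W) u x) x := by
  obtain ⟨hWd, hW'⟩ := contDiff_one_iff_deriv.1 hW
  have hWc := hWd.continuous
  rw [funext (pconv_eq_intervalIntegral hL W u), pconv_eq_intervalIntegral hL (deriv W) u]
  obtain ⟨C, hC⟩ := ((isCompact_closedBall x 1).prod
    (isCompact_Icc (a := -(L/2)) (b := L/2))).exists_bound_of_continuousOn
    (f := fun p : ℝ × ℝ => deriv W (p.1 - p.2) * u p.2) (by fun_prop)
  refine (intervalIntegral.hasDerivAt_integral_of_dominated_loc_of_deriv_le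
    (F := fun z y => W (z - y) * u y) (F' := fun z y => deriv W (z - y) * u y)
    (bound := fun _ => C) (Metric.closedBall_mem_nhds x one_pos) ?_ ?_ ?_ ?_ ?_ ?_).2
  · exact Filter.Eventually.of_forall fun z =>
      Continuous.aestronglyMeasurable (by fun_prop)
  · exact Continuous.intervalIntegrable (by fun_prop) _ _
  · exact Continuous.aestronglyMeasurable (by fun_prop)
  · refine Filter.Eventually.of_forall fun y hy z hz => hC (z, y) ⟨hz, ?_⟩
    rw [uIoc_of_le (by linarith)] at hy
    exact Ioc_subset_Icc_self hy
  · exact intervalIntegrable_const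
  · exact Filter.Eventually.of_forall fun y _ z _ =>
      ((hWd (z - y)).hasDerivAt.comp_sub_const z y).mul_const (u y)

theorem contDiff_pconv {L : ℝ} (hL : 0 ≤ L) {u : ℝ → ℝ} (hu : Continuous u) (n : ℕ)
    {W : ℝ → ℝ} (hW : ContDiff ℝ n W) : ContDiff ℝ n (pconv L W u) := by
  induction n generalizing W with
  | zero => exact contDiff_zero.2 (continuous_pconv hL hW.continuous hu)
  | succ n ih =>
    have hd := hasDerivAt_pconv hL (hW.of_le (by exact_mod_cast Nat.le_add_left 1 n)) hu
    push_cast at hW ⊢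
    rw [contDiff_succ_iff_deriv] at hW ⊢
    refine ⟨fun x => (hd x).differentiableAt, fun h => by simp at h, ?_⟩
    rw [funext fun x => (hd x).deriv]
    exact ih hW.2.2

/-- If `W, V` are L-periodic and C², and `u` is a continuous L-periodic fixed
point of `T`, then `u` is C², strictly positive, has unit mass, the stationary flux
`σ u' + κ u (W*u)' + u V'` vanishes identically, and in particular `u` is a classical
solution of the stationary equation `0 = d/dx(σ u' + κ u (W*u)' + u V')`. -/
theorem fixedPoint_is_stationary (L σ κ : ℝ) (hL : 0 < L) (hσ : 0 < σ) (hκ : 0 ≤ κ)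
    (W V : ℝ → ℝ) (hW : ContDiff ℝ 2 W) (hWper : Function.Periodic W L)
    (hV : ContDiff ℝ 2 V) (hVper : Function.Periodic V L)
    (u : ℝ → ℝ) (huc : Continuous u) (huper : Function.Periodic u L)
    (hfix : u = Tmap L σ κ W V u) :
    ContDiff ℝ 2 u ∧
    (∀ x : ℝ, 0 < u x) ∧
    (∫ x in Set.Ioc (-(L/2)) (L/2), u x) = 1 ∧
    (∀ x : ℝ, σ * deriv u x + κ * u x * deriv (pconv L W u) x + u x * deriv V x = 0) ∧
    (∀ x : ℝ, deriv (fun y => σ * deriv u y + κ * u y * deriv (pconv L W u) y + u y * deriv V y) x = 0) := by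
  have hP : ContDiff ℝ 2 (pconv L W u) := contDiff_pconv hL.le huc 2 hW
  have hE : ContDiff ℝ 2 fun y => Real.exp (-σ⁻¹ * (κ * pconv L W u y + V y)) := by fun_prop
  have hZ : 0 < Zfun L σ κ W V u := by
    rw [Zfun, ← intervalIntegral.integral_of_le (by linarith)]
    exact intervalIntegral.intervalIntegral_pos_of_pos
      (hE.continuous.intervalIntegrable _ _) (fun _ => Real.exp_pos _) (by linarith)
  have hux : ∀ x, u x = Real.exp (-σ⁻¹ * (κ * pconv L W u x + V x)) / Zfun L σ κ W V u :=
    fun x => congrFun hfix x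
  have hflux : ∀ x, σ * deriv u x + κ * u x * deriv (pconv L W u) x + u x * deriv V x = 0 := by
    intro x
    have hPx := (hP.differentiable two_ne_zero x).hasDerivAt
    have hVx := (hV.differentiable two_ne_zero x).hasDerivAt
    have hd := ((((hPx.const_mul κ).add hVx).const_mul (-σ⁻¹)).exp).div_const
      (Zfun L σ κ W V u)
    have hdu : deriv u x =
        u x * (-σ⁻¹ * (κ * deriv (pconv L W u) x + deriv V x)) := by
      refine (hd.congr_of_eventuallyEq (Filter.Eventually.of_forall hux)).deriv.trans ?_
      rw [hux x, div_mul_eq_mul_div]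
      rfl
    rw [hdu]
    field_simp
    ring
  refine ⟨?_, fun x => ?_, ?_, hflux, fun x => ?_⟩
  · rw [funext hux]
    exact hE.div_const _
  · rw [hux x]
    positivity
  · rw [funext hux, integral_div]
    exact div_self hZ.ne'
  · rw [funext hflux]
    exact deriv_const x 0
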